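/- Let H be a real Hilbert space and let g ∈ Γ₀(H). For each fixed x ∈ H, the function β ↦ g^β(x) is differentiable on (0, +∞) and satisfies the Hamilton–Jacobi equation (∂/∂β) g^β(x) = −(1/2)‖∇_x g^β(x)‖², where ∇_x g^β denotes the gradient of the Moreau envelope in the space variable. -/

import Mathlib

open RealInnerProductSpace

/-- `g ∈ Γ₀(H)` encoded with `EReal` values. -/
def IsProperConvexLsc {H : Type*} [NormedAddCommGroup H] [InnerProductSpace ℝ H]
    (g : H → EReal) : Prop :=
  (∃ x, g x ≠ ⊤) ∧ (∀ x, g x ≠ ⊥) ∧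
    (∀ x y : H, ∀ a b : ℝ, 0 ≤ a → 0 ≤ b → a + b = 1 →
      g (a • x + b • y) ≤ (a : EReal) * g x + (b : EReal) * g y) ∧
    LowerSemicontinuous g

/-- The Moreau envelope `g^β(x) = inf_y { g(y) + 1/(2β) ‖x - y‖² }`. -/
noncomputable def moreauEnv {H : Type*} [NormedAddCommGroup H] [InnerProductSpace ℝ H]
    (g : H → EReal) (β : ℝ) (x : H) : EReal :=
  ⨅ y : H, g y + (((2 * β)⁻¹ * ‖x - y‖ ^ 2 : ℝ) : EReal)

open Filter Topology

section

variable {H : Type*} [NormedAddCommGroup H] [InnerProductSpace ℝ H] {g : H → EReal}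

namespace IsProperConvexLsc

/-- On its effective domain, a function of `Γ₀(H)` is a real convex function. -/
lemma convexOn_toReal (hg : IsProperConvexLsc g) :
    ConvexOn ℝ {y | g y ≠ ⊤} (fun y => (g y).toReal) := by
  obtain ⟨-, hbot, hconv, -⟩ := hg
  have key : ∀ y z : H, g y ≠ ⊤ → g z ≠ ⊤ → ∀ a b : ℝ, 0 ≤ a → 0 ≤ b → a + b = 1 →
      g (a • y + b • z) ≤ ((a * (g y).toReal + b * (g z).toReal : ℝ) : EReal) := by
    intro y z hy hz a b ha hb hab
    have h := hconv y z a b ha hb hab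
    rw [← EReal.coe_toReal hy (hbot y), ← EReal.coe_toReal hz (hbot z)] at h
    exact_mod_cast h
  refine ⟨fun y hy z hz a b ha hb hab => ?_, fun y hy z hz a b ha hb hab => ?_⟩
  · exact ne_top_of_le_ne_top (EReal.coe_ne_top _) (key y z hy hz a b ha hb hab)
  · have h := EReal.toReal_le_toReal (key y z hy hz a b ha hb hab) (hbot _) (EReal.coe_ne_top _)
    rwa [EReal.toReal_coe] at h

/-- A function of `Γ₀(H)` is minorized by a function that decreases linearly in the distance to
a point. -/
lemma exists_sub_mul_norm_le (hg : IsProperConvexLsc g) :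
    ∃ (x₀ : H) (A B : ℝ), ∀ y, g y ≠ ⊤ → A - B * ‖y - x₀‖ ≤ (g y).toReal := by
  have hC := hg.convexOn_toReal
  obtain ⟨⟨x₀, hx₀⟩, hbot, -, hlsc⟩ := hg
  set r := (g x₀).toReal with hr
  have hlt : ((r - 1 : ℝ) : EReal) < g x₀ := by
    rw [← EReal.coe_toReal hx₀ (hbot x₀), ← hr]
    exact_mod_cast sub_one_lt r
  obtain ⟨δ, hδ, hball⟩ := Metric.eventually_nhds_iff.1 (hlsc x₀ _ hlt)
  have hball' : ∀ y, g y ≠ ⊤ → ‖y - x₀‖ < δ → r - 1 ≤ (g y).toReal := by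
    intro y hy hyd
    have h : ((r - 1 : ℝ) : EReal) < g y := hball (by rwa [dist_eq_norm])
    rw [← EReal.coe_toReal hy (hbot y)] at h
    exact_mod_cast h.le
  refine ⟨x₀, r - 1, 2 / δ, fun y hy => ?_⟩
  by_cases hyd : ‖y - x₀‖ < δ
  · have := hball' y hy hyd
    have : 0 ≤ 2 / δ * ‖y - x₀‖ := by positivity
    linarith
  · push Not at hyd
    have hn : 0 < ‖y - x₀‖ := hδ.trans_le hyd
    set t := δ / 2 / ‖y - x₀‖ with ht
    have ht0 : 0 < t := by positivity
    have htn : t * ‖y - x₀‖ = δ / 2 := by rw [ht]; field_simp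
    have ht1 : t ≤ 1 := by rw [ht, div_le_one hn]; linarith
    have hmem := hC.1 hx₀ hy (sub_nonneg.2 ht1) ht0.le (by ring)
    have hle := hC.2 hx₀ hy (sub_nonneg.2 ht1) ht0.le (by ring)
    have hlow := hball' _ hmem (by
      have : (1 - t) • x₀ + t • y - x₀ = t • (y - x₀) := by module
      rw [this, norm_smul, Real.norm_of_nonneg ht0.le, htn]; linarith)
    simp only [smul_eq_mul] at hle
    have hinv : 2 / δ * ‖y - x₀‖ * t = 1 := by
      rw [mul_assoc, mul_comm _ t, htn]; field_simp
    have : 0 ≤ t * ((g y).toReal - (r - 1 - 2 / δ * ‖y - x₀‖)) := by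
      have : t * ((g y).toReal - (r - 1 - 2 / δ * ‖y - x₀‖))
          = t * (g y).toReal - t * r + t + 2 / δ * ‖y - x₀‖ * t := by ring
      rw [this, hinv]
      linarith
    linarith [nonneg_of_mul_nonneg_right this ht0]

lemma moreauEnv_ne_bot (hg : IsProperConvexLsc g) {b : ℝ} (hb : 0 < b) (x : H) :
    moreauEnv g b x ≠ ⊥ := by
  obtain ⟨x₀, A, B, hAB⟩ := hg.exists_sub_mul_norm_le
  have hbot := hg.2.1
  suffices h : ((A - |B| * ‖x - x₀‖ - b * B ^ 2 / 2 : ℝ) : EReal) ≤ moreauEnv g b x from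
    ne_bot_of_le_ne_bot (EReal.coe_ne_bot _) h
  refine le_iInf fun y => ?_
  by_cases hy : g y = ⊤
  · rw [hy, EReal.top_add_coe]
    exact le_top
  rw [← EReal.coe_toReal hy (hbot y), ← EReal.coe_add, EReal.coe_le_coe_iff]
  have h₁ := hAB y hy
  have h₂ : ‖y - x₀‖ ≤ ‖x - y‖ + ‖x - x₀‖ := by
    have := norm_sub_le (x - x₀) (x - y)
    rw [sub_sub_sub_cancel_left] at this
    linarith
  have h₃ : B * ‖y - x₀‖ ≤ |B| * (‖x - y‖ + ‖x - x₀‖) :=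
    mul_le_mul (le_abs_self B) h₂ (norm_nonneg _) (abs_nonneg _)
  have h₄ : (2 * b)⁻¹ * ‖x - y‖ ^ 2 - |B| * ‖x - y‖ + b * B ^ 2 / 2
      = (2 * b)⁻¹ * (‖x - y‖ - b * |B|) ^ 2 := by
    rw [← sq_abs B]; field_simp; ring
  have h₅ : 0 ≤ (2 * b)⁻¹ * (‖x - y‖ - b * |B|) ^ 2 := by positivity
  linarith

lemma toReal_moreauEnv_le (hg : IsProperConvexLsc g) {b : ℝ} (hb : 0 < b) (x : H) {y : H}
    (hy : g y ≠ ⊤) :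
    (moreauEnv g b x).toReal ≤ (g y).toReal + (2 * b)⁻¹ * ‖x - y‖ ^ 2 := by
  have h : moreauEnv g b x ≤ (((g y).toReal + (2 * b)⁻¹ * ‖x - y‖ ^ 2 : ℝ) : EReal) := by
    rw [EReal.coe_add, EReal.coe_toReal hy (hg.2.1 y)]
    exact iInf_le _ y
  have h' := EReal.toReal_le_toReal h (hg.moreauEnv_ne_bot hb x) (EReal.coe_ne_top _)
  rwa [EReal.toReal_coe] at h'

lemma exists_lt_toReal_moreauEnv_add (hg : IsProperConvexLsc g) {b : ℝ} (hb : 0 < b) (x : H)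
    {ε : ℝ} (hε : 0 < ε) :
    ∃ y, g y ≠ ⊤ ∧
      (g y).toReal + (2 * b)⁻¹ * ‖x - y‖ ^ 2 < (moreauEnv g b x).toReal + ε := by
  have hbot := hg.moreauEnv_ne_bot hb x
  have htop : moreauEnv g b x ≠ ⊤ := by
    obtain ⟨y, hy⟩ := hg.1
    exact ne_top_of_le_ne_top (EReal.add_ne_top hy (EReal.coe_ne_top _)) (iInf_le _ y)
  have h : moreauEnv g b x < (((moreauEnv g b x).toReal + ε : ℝ) : EReal) := by
    conv_lhs => rw [← EReal.coe_toReal htop hbot]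
    exact_mod_cast lt_add_of_pos_right _ hε
  obtain ⟨y, hy⟩ := iInf_lt_iff.1 h
  have hyt : g y ≠ ⊤ := by
    intro h'
    rw [h', EReal.top_add_coe] at hy
    exact not_top_lt hy
  refine ⟨y, hyt, ?_⟩
  rw [← EReal.coe_toReal hyt (hg.2.1 y)] at hy
  exact_mod_cast hy

lemma toReal_midpoint_le (hg : IsProperConvexLsc g) {y z : H} (hy : g y ≠ ⊤) (hz : g z ≠ ⊤) :
    g ((1 / 2 : ℝ) • y + (1 / 2 : ℝ) • z) ≠ ⊤ ∧
      (g ((1 / 2 : ℝ) • y + (1 / 2 : ℝ) • z)).toReal ≤ ((g y).toReal + (g z).toReal) / 2 := by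
  have hC := hg.convexOn_toReal
  refine ⟨hC.1 hy hz (by norm_num) (by norm_num) (by norm_num), ?_⟩
  have h := hC.2 hy hz (show (0 : ℝ) ≤ 1 / 2 by norm_num) (show (0 : ℝ) ≤ 1 / 2 by norm_num)
    (by norm_num)
  simp only [smul_eq_mul] at h
  linarith

/-- Midpoint convexity of the Moreau envelope in its parameter. -/
lemma two_mul_toReal_moreauEnv_le (hg : IsProperConvexLsc g) {b c : ℝ} (hb : 0 < b) (hc : 0 < c)
    (x : H) :
    2 * (moreauEnv g ((b + c) / 2) x).toReal
      ≤ (moreauEnv g b x).toReal + (moreauEnv g c x).toReal := by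
  refine le_of_forall_pos_le_add fun ε hε => ?_
  obtain ⟨y, hy, hyl⟩ := hg.exists_lt_toReal_moreauEnv_add hb x (half_pos hε)
  obtain ⟨z, hz, hzl⟩ := hg.exists_lt_toReal_moreauEnv_add hc x (half_pos hε)
  obtain ⟨hm, hml⟩ := hg.toReal_midpoint_le hy hz
  have h := hg.toReal_moreauEnv_le (b := (b + c) / 2) (by positivity) x hm
  have hn : ‖x - ((1 / 2 : ℝ) • y + (1 / 2 : ℝ) • z)‖ ≤ (‖x - y‖ + ‖x - z‖) / 2 := by
    have : x - ((1 / 2 : ℝ) • y + (1 / 2 : ℝ) • z) = (1 / 2 : ℝ) • ((x - y) + (x - z)) := by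
      module
    rw [this, norm_smul, Real.norm_of_nonneg (by norm_num)]
    linarith [norm_add_le (x - y) (x - z)]
  have hp : 2 * ((2 * ((b + c) / 2))⁻¹ * ((‖x - y‖ + ‖x - z‖) / 2) ^ 2)
      ≤ (2 * b)⁻¹ * ‖x - y‖ ^ 2 + (2 * c)⁻¹ * ‖x - z‖ ^ 2 := by
    generalize ‖x - y‖ = s
    generalize ‖x - z‖ = t
    have : (2 * b)⁻¹ * s ^ 2 + (2 * c)⁻¹ * t ^ 2
        - 2 * ((2 * ((b + c) / 2))⁻¹ * ((s + t) / 2) ^ 2)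
        = (c * s - b * t) ^ 2 / (2 * b * c * (b + c)) := by
      field_simp; ring
    have : 0 ≤ (c * s - b * t) ^ 2 / (2 * b * c * (b + c)) := by positivity
    linarith
  have hq : (2 * ((b + c) / 2))⁻¹ * ‖x - ((1 / 2 : ℝ) • y + (1 / 2 : ℝ) • z)‖ ^ 2
      ≤ (2 * ((b + c) / 2))⁻¹ * ((‖x - y‖ + ‖x - z‖) / 2) ^ 2 := by gcongr
  linarith

/-- Two approximate minimizers in the definition of the Moreau envelope are close. -/
lemma norm_sub_sq_le (hg : IsProperConvexLsc g) {b : ℝ} (hb : 0 < b) {x y z : H} {ε δ : ℝ}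
    (hy : g y ≠ ⊤) (hz : g z ≠ ⊤)
    (hyε : (g y).toReal + (2 * b)⁻¹ * ‖x - y‖ ^ 2 ≤ (moreauEnv g b x).toReal + ε)
    (hzδ : (g z).toReal + (2 * b)⁻¹ * ‖x - z‖ ^ 2 ≤ (moreauEnv g b x).toReal + δ) :
    ‖y - z‖ ^ 2 ≤ 4 * b * (ε + δ) := by
  obtain ⟨hm, hml⟩ := hg.toReal_midpoint_le hy hz
  have h := hg.toReal_moreauEnv_le hb x hm
  have hpar : ‖x - ((1 / 2 : ℝ) • y + (1 / 2 : ℝ) • z)‖ ^ 2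
      = (‖x - y‖ ^ 2 + ‖x - z‖ ^ 2) / 2 - ‖y - z‖ ^ 2 / 4 := by
    have e₁ : x - ((1 / 2 : ℝ) • y + (1 / 2 : ℝ) • z) = (1 / 2 : ℝ) • ((x - y) + (x - z)) := by
      module
    have e₂ := parallelogram_law_with_norm ℝ (x - y) (x - z)
    rw [sub_sub_sub_cancel_left, norm_sub_rev z y] at e₂
    rw [e₁, norm_smul, Real.norm_of_nonneg (by norm_num), mul_pow]
    linarith
  rw [hpar] at h
  have h' : (2 * b)⁻¹ * ‖y - z‖ ^ 2 ≤ 2 * (ε + δ) := by linarith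
  rw [inv_mul_le_iff₀ (by positivity)] at h'
  linarith

/-- The Moreau envelope is touched from above by the quadratic centred at the proximal point. -/
lemma exists_prox [CompleteSpace H] (hg : IsProperConvexLsc g) {β : ℝ} (hβ : 0 < β) (x : H) :
    ∃ p : H, ∀ b : ℝ, 0 < b → ∀ z : H, (moreauEnv g b z).toReal
      ≤ (moreauEnv g β x).toReal + (2 * b)⁻¹ * ‖z - p‖ ^ 2 - (2 * β)⁻¹ * ‖x - p‖ ^ 2 := by
  choose y hy hyl using fun n : ℕ =>
    hg.exists_lt_toReal_moreauEnv_add hβ x (Nat.one_div_pos_of_nat (α := ℝ) (n := n))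
  have hε := tendsto_one_div_add_atTop_nhds_zero_nat (𝕜 := ℝ)
  have hcauchy : CauchySeq y := by
    refine cauchySeq_of_le_tendsto_0 (fun N : ℕ => √(4 * β * (1 / ((N : ℝ) + 1) + 1 / (N + 1))))
      (fun n m N hn hm => ?_) ?_
    · rw [dist_eq_norm]
      refine Real.le_sqrt_of_sq_le (hg.norm_sub_sq_le hβ (x := x) (hy n) (hy m) ?_ ?_)
      · exact (hyl n).le.trans (by gcongr)
      · exact (hyl m).le.trans (by gcongr)
    · simpa using ((hε.add hε).const_mul (4 * β)).sqrt
  obtain ⟨p, hp⟩ := cauchySeq_tendsto_of_complete hcauchy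
  refine ⟨p, fun b hb z => ?_⟩
  have hlim : Tendsto (fun n : ℕ => (moreauEnv g β x).toReal + 1 / ((n : ℝ) + 1)
      + (2 * b)⁻¹ * ‖z - y n‖ ^ 2 - (2 * β)⁻¹ * ‖x - y n‖ ^ 2) atTop
      (𝓝 ((moreauEnv g β x).toReal + 0
        + (2 * b)⁻¹ * ‖z - p‖ ^ 2 - (2 * β)⁻¹ * ‖x - p‖ ^ 2)) :=
    ((hε.const_add _).add (((hp.const_sub z).norm.pow 2).const_mul _)).sub
      (((hp.const_sub x).norm.pow 2).const_mul _)
  rw [add_zero] at hlim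
  refine ge_of_tendsto' hlim fun n => ?_
  linarith [hg.toReal_moreauEnv_le hb z (hy n), hyl n]

end IsProperConvexLsc

end

/-- A real function squeezed near `a` between two functions that agree at `a` and have the same
derivative there has that derivative too. -/
lemma HasDerivAt.of_le_of_le {l f u : ℝ → ℝ} {m a : ℝ} (hl : HasDerivAt l m a)
    (hu : HasDerivAt u m a) (hlf : ∀ᶠ b in 𝓝 a, l b ≤ f b) (hfu : ∀ᶠ b in 𝓝 a, f b ≤ u b)
    (hla : l a = f a) (hua : u a = f a) : HasDerivAt f m a := by
  rw [hasDerivAt_iff_isLittleO] at hl hu ⊢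
  rw [Asymptotics.isLittleO_iff] at hl hu ⊢
  intro c hc
  filter_upwards [hl hc, hu hc, hlf, hfu] with b h₁ h₂ h₃ h₄
  rw [Real.norm_eq_abs, abs_le] at h₁ h₂ ⊢
  rw [hla] at h₁
  rw [hua] at h₂
  constructor <;> linarith [h₁.1, h₂.2]

/-- **Lax–Hopf / Hamilton–Jacobi equation for the Moreau envelope.**
For `g ∈ Γ₀(H)` and each fixed `x ∈ H`, the function `β ↦ g^β(x)` is differentiable on
`(0, +∞)` with `(∂/∂β) g^β(x) = -(1/2) ‖∇ₓ g^β(x)‖²`, where `∇ₓ g^β` denotes the gradient of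
the Moreau envelope in the space variable (supplied here as `G β x` via `hGrad`). -/
theorem moreauEnv_hamilton_jacobi
    {H : Type*} [NormedAddCommGroup H] [InnerProductSpace ℝ H] [CompleteSpace H]
    (g : H → EReal) (hg : IsProperConvexLsc g)
    (G : ℝ → H → H)
    (hGrad : ∀ β : ℝ, 0 < β → ∀ x : H,
      HasGradientAt (fun z => (moreauEnv g β z).toReal) (G β x) x) :
    ∀ x : H, ∀ β : ℝ, 0 < β →
      HasDerivAt (fun b => (moreauEnv g b x).toReal) (-(1/2) * ‖G β x‖ ^ 2) β := by
  intro x β hβ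
  obtain ⟨p, hp⟩ := hg.exists_prox hβ x
  have hG : G β x = β⁻¹ • (x - p) := by
    have hquad : HasFDerivAt (fun z => (2 * β)⁻¹ * ‖z - p‖ ^ 2)
        ((2 * β)⁻¹ • (2 • innerSL ℝ (x - p))) x := by
      simpa using (((hasFDerivAt_id (𝕜 := ℝ) x).sub_const p).norm_sq).const_mul (2 * β)⁻¹
    have hmin : IsLocalMin
        (fun z => (2 * β)⁻¹ * ‖z - p‖ ^ 2 - (moreauEnv g β z).toReal) x :=
      Eventually.of_forall fun z => by
        have := hp β hβ z
        dsimp only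
        linarith
    have h := hmin.hasFDerivAt_eq_zero (hquad.sub (hGrad β hβ x).hasFDerivAt)
    refine ext_inner_right ℝ fun v => ?_
    have hv := DFunLike.congr_fun h v
    simp only [sub_apply, smul_apply, innerSL_apply_apply,
      InnerProductSpace.toDual_apply_apply, zero_apply, smul_eq_mul,
      nsmul_eq_mul, Nat.cast_ofNat, mul_inv] at hv
    rw [real_inner_smul_left]
    linarith
  have hval : -(1 / 2) * ‖G β x‖ ^ 2 = -(2 * β ^ 2)⁻¹ * ‖x - p‖ ^ 2 := by
    rw [hG, norm_smul, Real.norm_of_nonneg (by positivity)]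
    field_simp
  rw [hval]
  set u : ℝ → ℝ := fun b =>
    (moreauEnv g β x).toReal + (2 * b)⁻¹ * ‖x - p‖ ^ 2 - (2 * β)⁻¹ * ‖x - p‖ ^ 2 with hudef
  have huβ : u β = (moreauEnv g β x).toReal := by simp [hudef]
  have hu : HasDerivAt u (-(2 * β ^ 2)⁻¹ * ‖x - p‖ ^ 2) β := by
    have h := (((((hasDerivAt_id β).const_mul 2).fun_inv (by simpa using hβ.ne')).mul_const
      (‖x - p‖ ^ 2)).const_add (moreauEnv g β x).toReal).sub_const ((2 * β)⁻¹ * ‖x - p‖ ^ 2)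
    have e : -(2 * β ^ 2)⁻¹ * ‖x - p‖ ^ 2 = -(2 * 1) / (2 * β) ^ 2 * ‖x - p‖ ^ 2 := by
      field_simp
    rw [e]
    exact h
  have hl : HasDerivAt (fun b => 2 * u β - u (2 * β - b)) (-(2 * β ^ 2)⁻¹ * ‖x - p‖ ^ 2) β := by
    have hβ' : 2 * β - β = β := by ring
    have h := ((show HasDerivAt u _ (2 * β - β) by rw [hβ']; exact hu).comp_const_sub
      (2 * β) β).const_sub (2 * u β)
    rwa [neg_neg] at h
  refine hl.of_le_of_le hu ?_ ?_ ?_ huβ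
  · filter_upwards [Ioo_mem_nhds hβ (show β < 2 * β by linarith)] with b hb
    have hc : 0 < 2 * β - b := sub_pos.2 hb.2
    have h := hg.two_mul_toReal_moreauEnv_le hb.1 hc x
    rw [show (b + (2 * β - b)) / 2 = β by ring] at h
    have := hp _ hc x
    rw [huβ]
    simp only [hudef]
    linarith
  · filter_upwards [Ioi_mem_nhds hβ] with b hb using hp b hb x
  · rw [show 2 * β - β = β by ring, ← huβ]
    ring
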